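/- arXiv:2412.18049 — 4 statements merged into one kernel-verified Lean document; each statement's English description precedes it below -/
import Mathlib

section
/- Let P be a connected locally finite poset in which every maximal chain has at least three elements, and let l and l' be maximal chains of P that are not connected to each other. Then every element of P_l ∩ P_{l'} is either a minimal element or a maximal element of P. -/
open Relation

/-- `l ≈ l'` : `l` and `l'` are maximal chains of `P` having two common elements `x < y`. -/
def ChainApprox {P : Type*} [PartialOrder P] (l l' : Set P) : Prop :=
  IsMaxChain (· ≤ ·) l ∧ IsMaxChain (· ≤ ·) l' ∧
    ∃ x y : P, x < y ∧ x ∈ l ∧ x ∈ l' ∧ y ∈ l ∧ y ∈ l'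

/-- Two maximal chains are *connected* if they are related by the equivalence closure of `≈`. -/
def ChainConnected {P : Type*} [PartialOrder P] (l l' : Set P) : Prop :=
  Relation.EqvGen ChainApprox l l'

/-- `P_l`: the set of elements lying on some maximal chain connected to `l`. -/
def chainComponent {P : Type*} [PartialOrder P] (l : Set P) : Set P :=
  {x | ∃ m : Set P, ChainConnected l m ∧ x ∈ m}

/-- A poset is *connected* if any two of its elements are joined by a finite sequence of
comparability relations. -/
def PosetConnected (P : Type*) [PartialOrder P] : Prop :=
  ∀ x y : P, Relation.ReflTransGen (fun a b : P => a ≤ b ∨ b ≤ a) x y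

/-- Every maximal chain of `P` has at least three elements. -/
def MaxChainsBig (P : Type*) [PartialOrder P] : Prop :=
  ∀ c : Set P, IsMaxChain (· ≤ ·) c →
    ∃ x y z : P, x ∈ c ∧ y ∈ c ∧ z ∈ c ∧ x ≠ y ∧ x ≠ z ∧ y ≠ z

theorem ChainConnected.isMaxChain_iff {P : Type*} [PartialOrder P] {l m : Set P}
    (h : ChainConnected l m) : IsMaxChain (· ≤ ·) l ↔ IsMaxChain (· ≤ ·) m := by
  induction h with
  | rel _ _ h => exact iff_of_true h.1 h.2.1
  | refl => rfl
  | symm _ _ _ ih => exact ih.symm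
  | trans _ _ _ _ _ ih₁ ih₂ => exact ih₁.trans ih₂

theorem IsMaxChain.exists_lt_mem {P : Type*} [PartialOrder P] {m : Set P}
    (hm : IsMaxChain (· ≤ ·) m) {x : P} (hx : x ∈ m) (hmin : ¬ IsMin x) : ∃ a ∈ m, a < x := by
  obtain ⟨y, hy⟩ := not_isMin_iff.1 hmin
  by_contra! hne
  have hle : ∀ b ∈ m, x ≤ b := fun b hb =>
    (hm.1.total hx hb).elim id fun h => (h.eq_or_lt.resolve_right (hne b hb)).ge
  have hins : IsChain (· ≤ ·) (insert y m) :=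
    hm.1.insert fun b hb _ => Or.inl (hy.le.trans (hle b hb))
  have hmy : y ∈ m := hm.2 hins (Set.subset_insert y m) ▸ Set.mem_insert y m
  exact hne y hmy hy

theorem IsMaxChain.exists_gt_mem {P : Type*} [PartialOrder P] {m : Set P}
    (hm : IsMaxChain (· ≤ ·) m) {x : P} (hx : x ∈ m) (hmax : ¬ IsMax x) : ∃ b ∈ m, x < b :=
  IsMaxChain.exists_lt_mem (P := Pᵒᵈ) hm.symm hx hmax

theorem chainConnected_of_mem_of_lt_of_gt {P : Type*} [PartialOrder P] {m m' : Set P}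
    (hm : IsMaxChain (· ≤ ·) m) (hm' : IsMaxChain (· ≤ ·) m') {a x b : P}
    (hx : x ∈ m) (hx' : x ∈ m') (ha : a ∈ m) (hb : b ∈ m') (hax : a < x) (hxb : x < b) :
    ChainConnected m m' := by
  have hc : IsChain (· ≤ ·) ({a, x, b} : Set P) := by
    have hab := hax.trans hxb
    rintro y (rfl | rfl | rfl) z (rfl | rfl | rfl) - <;> simp [hax.le, hxb.le, hab.le]
  obtain ⟨n, hn, hsub⟩ := hc.exists_maxChain
  have han : a ∈ n := hsub (by simp)
  have hxn : x ∈ n := hsub (by simp)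
  have hbn : b ∈ n := hsub (by simp)
  exact .trans _ n _ (.rel _ _ ⟨hm, hn, a, x, hax, ha, han, hx, hxn⟩)
    (.rel _ _ ⟨hn, hm', x, b, hxb, hxn, hx', hbn, hb⟩)

theorem stmt1 {P : Type*} [PartialOrder P] [LocallyFiniteOrder P]
    (hP : PosetConnected P) (hbig : MaxChainsBig P)
    (l l' : Set P) (hl : IsMaxChain (· ≤ ·) l) (hl' : IsMaxChain (· ≤ ·) l')
    (hnc : ¬ ChainConnected l l') :
    ∀ x ∈ chainComponent l ∩ chainComponent l', IsMin x ∨ IsMax x := by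
  rintro x ⟨⟨m, hlm, hxm⟩, m', hlm', hxm'⟩
  by_contra! hx
  have hm := hlm.isMaxChain_iff.1 hl
  have hm' := hlm'.isMaxChain_iff.1 hl'
  obtain ⟨a, ha, hax⟩ := hm.exists_lt_mem hxm hx.1
  obtain ⟨b, hb, hxb⟩ := hm'.exists_gt_mem hxm' hx.2
  exact hnc (.trans _ _ _ hlm (.trans _ _ _
    (chainConnected_of_mem_of_lt_of_gt hm hm' hxm hxm' ha hb hax hxb) (.symm _ _ hlm')))
end

section
/- Let b be an additive biderivation of I(P,R), and let C and C' be two distinct connected components of P. If α, β ∈ I(P,R) satisfy α(x,y) = 0 unless x, y ∈ C, and β(u,v) = 0 unless u, v ∈ C', then b(α, β) = 0. -/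
open Relation

namespace IncidenceAlgebra

variable {R P : Type*} [CommRing R] [PartialOrder P]

open Classical in
/-- The diagonal idempotent of the incidence algebra supported on `s`. -/
noncomputable def diagIndicator (R : Type*) [CommRing R] (s : Set P) : IncidenceAlgebra R P :=
  ⟨fun x y => if x = y ∧ x ∈ s then 1 else 0, fun _ _ h => if_neg fun h' => h h'.1.le⟩

open Classical in
theorem diagIndicator_apply (s : Set P) (x y : P) :
    diagIndicator R s x y = if x = y ∧ x ∈ s then 1 else 0 := rfl

variable [LocallyFiniteOrder P]

open Classical in
theorem diagIndicator_mul_apply (s : Set P) (f : IncidenceAlgebra R P) (x y : P) :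
    (diagIndicator R s * f) x y = if x ∈ s then f x y else 0 := by
  by_cases hxy : x ≤ y
  · rw [mul_apply, Finset.sum_eq_single x]
    · simp [diagIndicator_apply]
    · intro z _ hz
      simp [diagIndicator_apply, hz.symm]
    · simp [hxy]
  · simp [apply_eq_zero_of_not_le hxy]

open Classical in
theorem mul_diagIndicator_apply (s : Set P) (f : IncidenceAlgebra R P) (x y : P) :
    (f * diagIndicator R s) x y = if y ∈ s then f x y else 0 := by
  by_cases hxy : x ≤ y
  · rw [mul_apply, Finset.sum_eq_single y]
    · simp [diagIndicator_apply]
    · intro z _ hz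
      simp [diagIndicator_apply, hz]
    · simp [hxy]
  · simp [apply_eq_zero_of_not_le hxy]

theorem diagIndicator_mul_self (s : Set P) :
    diagIndicator R s * diagIndicator R s = diagIndicator R s := by
  ext x y
  simp only [diagIndicator_mul_apply, diagIndicator_apply]
  split_ifs <;> tauto

open Classical in
theorem diagIndicator_commute {s : Set P} (hs : ∀ x y : P, x ≤ y → (x ∈ s ↔ y ∈ s))
    (f : IncidenceAlgebra R P) : diagIndicator R s * f = f * diagIndicator R s := by
  ext x y hxy
  rw [diagIndicator_mul_apply, mul_diagIndicator_apply]
  exact if_congr (hs x y hxy) rfl rfl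

theorem diagIndicator_mul_eq_self {s : Set P} {f : IncidenceAlgebra R P}
    (hf : ∀ x y : P, ¬ (x ∈ s ∧ y ∈ s) → f x y = 0) : diagIndicator R s * f = f := by
  ext x y
  rw [diagIndicator_mul_apply]
  split_ifs with hx
  · rfl
  · exact (hf x y fun h => hx h.1).symm

end IncidenceAlgebra

/-- A map satisfying the Leibniz rule vanishes at central idempotents. -/
theorem leibniz_idempotent_eq_zero {A : Type*} [NonUnitalRing A] {d : A → A}
    (hd : ∀ f g, d (f * g) = f * d g + d f * g) {e : A} (he : e * e = e)
    (hc : ∀ f, e * f = f * e) : d e = 0 := by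
  have h : d e = e * d e + e * d e := by
    have := hd e e
    rwa [he, ← hc] at this
  have h' : e * d e = e * d e + e * d e := by
    conv_lhs => rw [h, mul_add, ← mul_assoc, he]
  have h0 : e * d e = 0 := left_eq_add.mp h'
  rw [h, h0, add_zero]

theorem leibniz_eq_idempotent_mul {A : Type*} [NonUnitalRing A] {d : A → A}
    (hd : ∀ f g, d (f * g) = f * d g + d f * g) {e f : A} (he : e * e = e)
    (hc : ∀ f, e * f = f * e) (hf : e * f = f) : d f = e * d f := by
  conv_lhs => rw [← hf, hd, leibniz_idempotent_eq_zero hd he hc, zero_mul, add_zero]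

theorem mem_component_iff_of_le {P : Type*} [PartialOrder P] (a x y : P) (hxy : x ≤ y) :
    x ∈ {z : P | ReflTransGen (fun s t : P => s ≤ t ∨ t ≤ s) a z} ↔
      y ∈ {z : P | ReflTransGen (fun s t : P => s ≤ t ∨ t ≤ s) a z} :=
  ⟨fun h => h.tail (Or.inl hxy), fun h => h.tail (Or.inr hxy)⟩

theorem component_eq_of_mem {P : Type*} [PartialOrder P] {a x : P}
    (hx : ReflTransGen (fun s t : P => s ≤ t ∨ t ≤ s) a x) :
    {z : P | ReflTransGen (fun s t : P => s ≤ t ∨ t ≤ s) a z} =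
      {z : P | ReflTransGen (fun s t : P => s ≤ t ∨ t ≤ s) x z} := by
  have : Std.Symm fun s t : P => s ≤ t ∨ t ≤ s := ⟨fun _ _ => Or.symm⟩
  ext z
  exact ⟨fun h => (ReflTransGen.stdSymm.symm _ _ hx).trans h, fun h => hx.trans h⟩

theorem stmt10 {R P : Type*} [CommRing R] [PartialOrder P] [LocallyFiniteOrder P] [DecidableEq P]
    (b : IncidenceAlgebra R P → IncidenceAlgebra R P → IncidenceAlgebra R P)
    (hb_add₁ : ∀ f g h : IncidenceAlgebra R P, b (f + g) h = b f h + b g h)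
    (hb_add₂ : ∀ f g h : IncidenceAlgebra R P, b f (g + h) = b f g + b f h)
    (hb_mul₁ : ∀ f g h : IncidenceAlgebra R P, b (f * g) h = f * b g h + b f h * g)
    (hb_mul₂ : ∀ f g h : IncidenceAlgebra R P, b f (g * h) = g * b f h + b f g * h)
    (C C' : Set P) (a a' : P)
    (hC : C = {y : P | Relation.ReflTransGen (fun s t : P => s ≤ t ∨ t ≤ s) a y})
    (hC' : C' = {y : P | Relation.ReflTransGen (fun s t : P => s ≤ t ∨ t ≤ s) a' y})
    (hne : C ≠ C')
    (α β : IncidenceAlgebra R P)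
    (hα : ∀ x y : P, ¬ (x ∈ C ∧ y ∈ C) → α x y = 0)
    (hβ : ∀ u v : P, ¬ (u ∈ C' ∧ v ∈ C') → β u v = 0) :
    b α β = 0 := by
  have hle : ∀ x y : P, x ≤ y → (x ∈ C ↔ y ∈ C) := hC ▸ mem_component_iff_of_le a
  have hle' : ∀ x y : P, x ≤ y → (x ∈ C' ↔ y ∈ C') := hC' ▸ mem_component_iff_of_le a'
  have h₁ := leibniz_eq_idempotent_mul (d := fun f => b f β) (fun f g => hb_mul₁ f g β)
    (IncidenceAlgebra.diagIndicator_mul_self C) (IncidenceAlgebra.diagIndicator_commute hle)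
    (IncidenceAlgebra.diagIndicator_mul_eq_self hα)
  have h₂ := leibniz_eq_idempotent_mul (d := b α) (hb_mul₂ α)
    (IncidenceAlgebra.diagIndicator_mul_self C') (IncidenceAlgebra.diagIndicator_commute hle')
    (IncidenceAlgebra.diagIndicator_mul_eq_self hβ)
  ext x y
  by_cases hx : x ∈ C
  · have hx' : x ∉ C' := by
      intro hx'
      subst hC hC'
      exact hne ((component_eq_of_mem hx).trans (component_eq_of_mem hx').symm)
    rw [h₂, IncidenceAlgebra.diagIndicator_mul_apply, if_neg hx', IncidenceAlgebra.zero_apply]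
  · rw [h₁, IncidenceAlgebra.diagIndicator_mul_apply, if_neg hx, IncidenceAlgebra.zero_apply]
end

section
/- Let b be an additive biderivation of I(P,R). Then for all α, β, γ, δ ∈ I(P,R), one has b(α,β)·[γ,δ] = [α,β]·b(γ,δ), where [f,g] = fg − gf. -/
open Relation

theorem stmt11 {R P : Type*} [CommRing R] [PartialOrder P] [LocallyFiniteOrder P] [DecidableEq P]
    (b : IncidenceAlgebra R P → IncidenceAlgebra R P → IncidenceAlgebra R P)
    (hb_add₁ : ∀ f g h : IncidenceAlgebra R P, b (f + g) h = b f h + b g h)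
    (hb_add₂ : ∀ f g h : IncidenceAlgebra R P, b f (g + h) = b f g + b f h)
    (hb_mul₁ : ∀ f g h : IncidenceAlgebra R P, b (f * g) h = f * b g h + b f h * g)
    (hb_mul₂ : ∀ f g h : IncidenceAlgebra R P, b f (g * h) = g * b f h + b f g * h)
    (α β γ δ : IncidenceAlgebra R P) :
    b α β * (γ * δ - δ * γ) = (α * β - β * α) * b γ δ := by
  -- Expand `b (α * γ) (β * δ)` by the Leibniz rule in both possible orders.
  have h₁ := hb_mul₁ α γ (β * δ)
  rw [hb_mul₂ (α * γ), hb_mul₁, hb_mul₁, hb_mul₂ γ, hb_mul₂ α] at h₁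
  rw [← sub_eq_zero] at h₁ ⊢
  rw [← h₁]
  noncomm_ring
end

section
/- Let P be a locally finite poset with at least three elements in which every maximal chain is infinite, and let b be an additive biderivation of I(P,R). Then there exists a function λ : P × P → R such that λ(x,y) = λ(u,v) whenever x < y, u < v, and there exist connected maximal chains l ∋ x, y and l' ∋ u, v, and such that for all α, β ∈ I(P,R) and all x ≤ z in P, b(α,β)(x,z) = λ(x,z)·(αβ − βα)(x,z). (This is the pointwise form of the statement that every additive biderivation of I(P,R) is a sum of inner biderivations.) -/
open Relation

section Ring

variable {A : Type*} [Ring A] {b : A → A → A}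

/-- A biderivation intertwines with the commutator. -/
theorem biderivation_mul_commutator
    (hmul₁ : ∀ f g h, b (f * g) h = f * b g h + b f h * g)
    (hmul₂ : ∀ f g h, b f (g * h) = g * b f h + b f g * h) (x y u v : A) :
    b x y * (u * v - v * u) = (x * y - y * x) * b u v := by
  have h₁ := hmul₁ x u (y * v)
  have h₂ := hmul₂ (x * u) y v
  rw [h₁, hmul₂, hmul₂, hmul₁, hmul₁] at h₂
  rw [← sub_eq_zero] at h₂ ⊢
  rw [← neg_eq_zero, ← h₂]
  noncomm_ring

/-- Brešar's identity for biderivations of a ring. -/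
theorem biderivation_mul_mul_commutator
    (hmul₁ : ∀ f g h, b (f * g) h = f * b g h + b f h * g)
    (hmul₂ : ∀ f g h, b f (g * h) = g * b f h + b f g * h) (x y z u v : A) :
    b x y * z * (u * v - v * u) = (x * y - y * x) * z * b u v := by
  have h₁ := biderivation_mul_commutator hmul₁ hmul₂ x y (z * u) v
  have h₂ := biderivation_mul_commutator hmul₁ hmul₂ x y z v
  calc b x y * z * (u * v - v * u)
      = b x y * (z * u * v - v * (z * u)) - b x y * (z * v - v * z) * u := by noncomm_ring
    _ = (x * y - y * x) * z * b u v := by rw [h₁, h₂, hmul₁]; noncomm_ring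

end Ring

namespace IncidenceAlgebra

variable {R P : Type*} [CommRing R] [PartialOrder P] [DecidableEq P]

/-- The matrix unit of the incidence algebra at a pair `p ≤ q`. -/
def matrixUnit (R : Type*) [CommRing R] {p q : P} (h : p ≤ q) : IncidenceAlgebra R P where
  toFun a c := if a = p ∧ c = q then 1 else 0
  eq_zero_of_not_le' _ _ hac := if_neg fun ⟨ha, hc⟩ => hac (ha ▸ hc ▸ h)

theorem matrixUnit_apply {p q : P} (h : p ≤ q) (a c : P) :
    matrixUnit R h a c = if a = p ∧ c = q then 1 else 0 := rfl

variable [LocallyFiniteOrder P]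

theorem mul_matrixUnit_apply (f : IncidenceAlgebra R P) {p q : P} (h : p ≤ q) (a c : P) :
    (f * matrixUnit R h) a c = if c = q then f a p else 0 := by
  rw [mul_apply]
  split_ifs with hc
  · subst hc
    rw [Finset.sum_eq_single p]
    · simp [matrixUnit_apply]
    · intro w _ hw
      simp [matrixUnit_apply, hw]
    · intro hp
      rw [apply_eq_zero_of_not_le (fun hap => hp (Finset.mem_Icc.2 ⟨hap, h⟩)), zero_mul]
  · simp [matrixUnit_apply, hc]

theorem matrixUnit_mul_apply (f : IncidenceAlgebra R P) {p q : P} (h : p ≤ q) (a c : P) :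
    (matrixUnit R h * f) a c = if a = p then f q c else 0 := by
  rw [mul_apply]
  split_ifs with ha
  · subst ha
    rw [Finset.sum_eq_single q]
    · simp [matrixUnit_apply]
    · intro w _ hw
      simp [matrixUnit_apply, hw]
    · intro hq
      rw [apply_eq_zero_of_not_le (fun hqc => hq (Finset.mem_Icc.2 ⟨h, hqc⟩)), mul_zero]
  · simp [matrixUnit_apply, ha]

theorem mul_matrixUnit_mul_apply (f g : IncidenceAlgebra R P) {p q : P} (h : p ≤ q) (a c : P) :
    (f * matrixUnit R h * g) a c = f a p * g q c := by
  rw [mul_assoc, mul_apply, Finset.sum_eq_single p]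
  · rw [matrixUnit_mul_apply, if_pos rfl]
  · intro w _ hw
    rw [matrixUnit_mul_apply, if_neg hw, mul_zero]
  · intro hp
    rw [matrixUnit_mul_apply, if_pos rfl]
    by_cases hap : a ≤ p
    · rw [apply_eq_zero_of_not_le (fun hqc => hp (Finset.mem_Icc.2 ⟨hap, h.trans hqc⟩)) g, mul_zero]
    · rw [apply_eq_zero_of_not_le hap, zero_mul]

theorem commutator_matrixUnit {p q : P} (h : p < q) :
    matrixUnit R (le_refl p) * matrixUnit R h.le - matrixUnit R h.le * matrixUnit R (le_refl p) =
      matrixUnit R h.le := by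
  ext a c
  rw [sub_apply, matrixUnit_mul_apply, mul_matrixUnit_apply]
  simp only [matrixUnit_apply, h.ne, and_false, if_false, ite_self, sub_zero, true_and, ite_and]

variable {b : IncidenceAlgebra R P → IncidenceAlgebra R P → IncidenceAlgebra R P}

/-- The factor by which a biderivation differs from the commutator at a pair `p < q`; it is `0`
at other pairs. -/
noncomputable def biderivationFactor
    (b : IncidenceAlgebra R P → IncidenceAlgebra R P → IncidenceAlgebra R P) (p q : P) : R :=
  open Classical in
  if h : p < q then b (matrixUnit R (le_refl p)) (matrixUnit R h.le) p q else 0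

theorem biderivation_apply_of_le_left
    (hmul₁ : ∀ f g h, b (f * g) h = f * b g h + b f h * g)
    (hmul₂ : ∀ f g h, b f (g * h) = g * b f h + b f g * h)
    (f g : IncidenceAlgebra R P) (a : P) {z p q : P} (hzp : z ≤ p) (hpq : p < q) :
    b f g a z = biderivationFactor b p q * (f * g - g * f) a z := by
  have key := biderivation_mul_mul_commutator hmul₁ hmul₂ f g (matrixUnit R hzp)
    (matrixUnit R (le_refl p)) (matrixUnit R hpq.le)
  rw [commutator_matrixUnit hpq] at key
  have h := DFunLike.congr_fun key a
  replace h := congrFun h q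
  rw [mul_matrixUnit_mul_apply, mul_matrixUnit_mul_apply, matrixUnit_apply,
    if_pos ⟨rfl, rfl⟩, mul_one] at h
  rw [biderivationFactor, dif_pos hpq, h, mul_comm]

theorem biderivation_apply_of_le_right
    (hmul₁ : ∀ f g h, b (f * g) h = f * b g h + b f h * g)
    (hmul₂ : ∀ f g h, b f (g * h) = g * b f h + b f g * h)
    (f g : IncidenceAlgebra R P) {p q w : P} (c : P) (hpq : p < q) (hqw : q ≤ w) :
    b f g w c = biderivationFactor b p q * (f * g - g * f) w c := by
  have key := biderivation_mul_mul_commutator hmul₁ hmul₂ (matrixUnit R (le_refl p))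
    (matrixUnit R hpq.le) (matrixUnit R hqw) f g
  rw [commutator_matrixUnit hpq] at key
  have h := DFunLike.congr_fun key p
  replace h := congrFun h c
  rw [mul_matrixUnit_mul_apply, mul_matrixUnit_mul_apply, matrixUnit_apply,
    if_pos ⟨rfl, rfl⟩, one_mul] at h
  rw [biderivationFactor, dif_pos hpq, h]

theorem biderivationFactor_eq
    (hmul₁ : ∀ f g h, b (f * g) h = f * b g h + b f h * g)
    (hmul₂ : ∀ f g h, b f (g * h) = g * b f h + b f g * h)
    {x y u v : P} (hxy : x < y) (hyu : y ≤ u) (huv : u < v) :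
    biderivationFactor b x y = biderivationFactor b u v := by
  have h := biderivation_apply_of_le_left hmul₁ hmul₂ (matrixUnit R (le_refl x))
    (matrixUnit R hxy.le) x hyu huv
  rw [commutator_matrixUnit hxy, matrixUnit_apply, if_pos ⟨rfl, rfl⟩, mul_one] at h
  rw [← h, biderivationFactor, dif_pos hxy]

end IncidenceAlgebra

section Chain

variable {P : Type*} [PartialOrder P] {l : Set P}

theorem IsChain.exists_lt_or_lt_of_infinite [LocallyFiniteOrder P]
    (hl : IsChain (· ≤ ·) l) (hinf : l.Infinite) {m M : P} (hm : m ∈ l) (hM : M ∈ l) :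
    ∃ w ∈ l, w < m ∨ M < w := by
  by_contra! h
  refine hinf ((Set.finite_Icc m M).subset fun w hw => ⟨?_, ?_⟩)
  · exact (hl.total hm hw).elim id fun hwm => (hwm.eq_of_not_lt (h w hw).1).ge
  · exact (hl.total hw hM).elim id fun hMw => (hMw.eq_of_not_lt (h w hw).2).ge

theorem IsChain.exists_mem_ge_ge (hl : IsChain (· ≤ ·) l) {x y : P} (hx : x ∈ l) (hy : y ∈ l) :
    ∃ M ∈ l, x ≤ M ∧ y ≤ M :=
  (hl.total hx hy).elim (fun h => ⟨y, hy, h, le_rfl⟩) fun h => ⟨x, hx, le_rfl, h⟩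

theorem IsChain.exists_mem_le_le (hl : IsChain (· ≤ ·) l) {x y : P} (hx : x ∈ l) (hy : y ∈ l) :
    ∃ m ∈ l, m ≤ x ∧ m ≤ y :=
  (hl.total hx hy).elim (fun h => ⟨x, hx, le_rfl, h⟩) fun h => ⟨y, hy, h, le_rfl⟩

theorem IsChain.exists_lt_of_infinite (hl : IsChain (· ≤ ·) l) (hinf : l.Infinite) :
    ∃ x ∈ l, ∃ y ∈ l, x < y := by
  obtain ⟨x, hx, y, hy, hxy⟩ := hinf.nontrivial
  exact (hl.total hx hy).elim (fun h => ⟨x, hx, y, hy, h.lt_of_ne hxy⟩)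
    fun h => ⟨y, hy, x, hx, h.lt_of_ne hxy.symm⟩

/-- In a poset all of whose maximal chains are infinite, a function of pairs that is constant
on each maximal chain is constant along connected maximal chains. -/
theorem ChainConnected.eq_of_eq_on_chains {S : Type*} {φ : P → P → S}
    (hinf : ∀ c : Set P, IsMaxChain (· ≤ ·) c → c.Infinite)
    (hφ : ∀ c : Set P, IsMaxChain (· ≤ ·) c → ∀ x ∈ c, ∀ y ∈ c, ∀ u ∈ c, ∀ v ∈ c,
      x < y → u < v → φ x y = φ u v)
    {l' : Set P} (h : ChainConnected l l') :
    (IsMaxChain (· ≤ ·) l ↔ IsMaxChain (· ≤ ·) l') ∧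
      (IsMaxChain (· ≤ ·) l → ∀ x ∈ l, ∀ y ∈ l, ∀ u ∈ l', ∀ v ∈ l',
        x < y → u < v → φ x y = φ u v) := by
  induction h with
  | rel c c' h =>
    obtain ⟨hc, hc', p, q, hpq, hp, hp', hq, hq'⟩ := h
    exact ⟨iff_of_true hc hc', fun _ x hx y hy u hu v hv hxy huv =>
      (hφ c hc x hx y hy p hp q hq hxy hpq).trans (hφ c' hc' p hp' q hq' u hu v hv hpq huv)⟩
  | refl c => exact ⟨Iff.rfl, hφ c⟩
  | symm c c' _ ih =>
    exact ⟨ih.1.symm, fun hc' x hx y hy u hu v hv hxy huv =>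
      (ih.2 (ih.1.2 hc') u hu v hv x hx y hy huv hxy).symm⟩
  | trans c c' c'' _ _ ih ih' =>
    refine ⟨ih.1.trans ih'.1, fun hc x hx y hy u hu v hv hxy huv => ?_⟩
    have hc' := ih.1.1 hc
    obtain ⟨p, hp, q, hq, hpq⟩ := hc'.isChain.exists_lt_of_infinite (hinf c' hc')
    exact (ih.2 hc x hx y hy p hp q hq hxy hpq).trans (ih'.2 hc' p hp q hq u hu v hv hpq huv)

end Chain

theorem stmt19 {R P : Type*} [CommRing R] [PartialOrder P] [LocallyFiniteOrder P] [DecidableEq P]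
    (hthree : ∃ x y z : P, x ≠ y ∧ x ≠ z ∧ y ≠ z)
    (hinf : ∀ c : Set P, IsMaxChain (· ≤ ·) c → c.Infinite)
    (b : IncidenceAlgebra R P → IncidenceAlgebra R P → IncidenceAlgebra R P)
    (hb_add₁ : ∀ f g h : IncidenceAlgebra R P, b (f + g) h = b f h + b g h)
    (hb_add₂ : ∀ f g h : IncidenceAlgebra R P, b f (g + h) = b f g + b f h)
    (hb_mul₁ : ∀ f g h : IncidenceAlgebra R P, b (f * g) h = f * b g h + b f h * g)
    (hb_mul₂ : ∀ f g h : IncidenceAlgebra R P, b f (g * h) = g * b f h + b f g * h)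
 :
    ∃ lam : P → P → R,
      (∀ x y u v : P, x < y → u < v →
        (∃ l l' : Set P, IsMaxChain (· ≤ ·) l ∧ IsMaxChain (· ≤ ·) l' ∧
          x ∈ l ∧ y ∈ l ∧ u ∈ l' ∧ v ∈ l' ∧ ChainConnected l l') →
        lam x y = lam u v) ∧
      (∀ α β : IncidenceAlgebra R P, ∀ x z : P, x ≤ z →
        b α β x z = lam x z * (α * β - β * α) x z) := by
  have hle : ∀ f g : IncidenceAlgebra R P, ∀ a : P, ∀ {z p q : P}, z ≤ p → p < q → _ :=
    IncidenceAlgebra.biderivation_apply_of_le_left hb_mul₁ hb_mul₂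
  have hge : ∀ f g : IncidenceAlgebra R P, ∀ {p q w : P}, ∀ c : P, p < q → q ≤ w → _ :=
    IncidenceAlgebra.biderivation_apply_of_le_right hb_mul₁ hb_mul₂
  have heq : ∀ {x y u v : P}, x < y → y ≤ u → u < v → _ :=
    IncidenceAlgebra.biderivationFactor_eq hb_mul₁ hb_mul₂
  refine ⟨IncidenceAlgebra.biderivationFactor b, ?_, ?_⟩
  · rintro x y u v hxy huv ⟨l, l', hl, -, hx, hy, hu, hv, hll'⟩
    refine (hll'.eq_of_eq_on_chains hinf ?_).2 hl x hx y hy u hu v hv hxy huv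
    intro c hc x hx y hy u hu v hv hxy huv
    obtain ⟨m, hm, hmx, hmu⟩ := hc.isChain.exists_mem_le_le hx hu
    obtain ⟨M, hM, hyM, hvM⟩ := hc.isChain.exists_mem_ge_ge hy hv
    obtain ⟨w, -, hw | hw⟩ := hc.isChain.exists_lt_or_lt_of_infinite (hinf c hc) hm hM
    · exact (heq hw hmx hxy).symm.trans (heq hw hmu huv)
    · exact (heq hxy hyM hw).trans (heq huv hvM hw).symm
  · intro α β x z hxz
    obtain ⟨c, hc, hsub⟩ := (IsChain.pair hxz : IsChain (· ≤ ·) {x, z}).exists_maxChain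
    obtain ⟨w, -, hw⟩ := hc.isChain.exists_lt_or_lt_of_infinite (hinf c hc)
      (hsub (Set.mem_insert x _)) (hsub (Set.mem_insert_of_mem x rfl))
    obtain rfl | hlt := hxz.eq_or_lt
    · have h0 : (α * β - β * α) x x = 0 := by
        simp [IncidenceAlgebra.sub_apply, mul_comm]
      obtain hw | hw := hw
      · rw [hge α β x hw le_rfl, h0, mul_zero, mul_zero]
      · rw [hle α β x le_rfl hw, h0, mul_zero, mul_zero]
    · obtain hw | hw := hw
      · rw [hge α β z hw le_rfl, heq hw le_rfl hlt]
      · rw [hle α β x le_rfl hw, heq hlt le_rfl hw]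
end
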